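/- Suppose Assumptions 1–4 below hold (with δ_H ∈ [0,1]), the noise satisfies the second-moment martingale-difference condition, and the step sizes satisfy the appendix step-size assumption. Then for every t ≥ 0, almost surely E[‖ŷ_{t+1}‖² | F_t] ≤ (1 − μ_Gβ_t)‖ŷ_t‖² + L_{G,x}²β_t²‖x̂_t‖² + 2L_{G,x}β_t√(1 − μ_Gβ_t)·‖x̂_t‖‖ŷ_t‖ + Γ₂₂β_t². -/

import Mathlib

set_option autoImplicit false

open MeasureTheory Filter
open scoped RealInnerProductSpace

noncomputable section

/-- Spectral norm of a rectangular real matrix (the operator norm of the induced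
linear map between Euclidean spaces). -/
def specNorm {m n : ℕ} (A : Matrix (Fin m) (Fin n) ℝ) : ℝ :=
  ‖LinearMap.toContinuousLinearMap (Matrix.toEuclideanLin A)‖

/-- The σ-algebra `𝔉 t = σ(x₀, y₀, ξ₀, ψ₀, …, ξ_{t-1}, ψ_{t-1})`. -/
def natFilt {Ω : Type} [MeasurableSpace Ω] {dx dy : ℕ}
    (x0 : Ω → EuclideanSpace ℝ (Fin dx)) (y0 : Ω → EuclideanSpace ℝ (Fin dy))
    (ξ : ℕ → Ω → EuclideanSpace ℝ (Fin dx)) (ψ : ℕ → Ω → EuclideanSpace ℝ (Fin dy))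
    (t : ℕ) : MeasurableSpace Ω :=
  MeasurableSpace.comap x0 inferInstance ⊔ MeasurableSpace.comap y0 inferInstance ⊔
    ⨆ s ∈ Finset.range t,
      (MeasurableSpace.comap (ξ s) inferInstance ⊔ MeasurableSpace.comap (ψ s) inferInstance)

/-- If `u` is `m`-measurable and `v` is conditionally centred given `m`, the cross term in the
conditional second moment of `u - b • v` vanishes. -/
theorem condExp_norm_sub_smul_sq {Ω E : Type*} {m m0 : MeasurableSpace Ω} {μ : Measure Ω}
    [IsFiniteMeasure μ] [NormedAddCommGroup E] [InnerProductSpace ℝ E] [CompleteSpace E]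
    (hm : m ≤ m0) {u v : Ω → E} (b : ℝ) (hum : StronglyMeasurable[m] u)
    (hu : MemLp u 2 μ) (hv : MemLp v 2 μ) (hv0 : μ[v | m] =ᵐ[μ] 0) :
    μ[fun ω => ‖u ω - b • v ω‖ ^ 2 | m] =ᵐ[μ]
      fun ω => ‖u ω‖ ^ 2 + b ^ 2 * (μ[fun ω' => ‖v ω'‖ ^ 2 | m]) ω := by
  have hu2 : Integrable (fun ω => ‖u ω‖ ^ 2) μ := (memLp_two_iff_integrable_sq_norm hu.1).1 hu
  have hv2 : Integrable (fun ω => ‖v ω‖ ^ 2) μ := (memLp_two_iff_integrable_sq_norm hv.1).1 hv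
  have huv : Integrable (fun ω => ⟪u ω, v ω⟫) μ :=
    (hu.norm.integrable_mul hv.norm).mono (hu.1.inner hv.1) (ae_of_all _ fun ω => by
      simpa using abs_real_inner_le_norm (u ω) (v ω))
  have hcross : μ[fun ω => ⟪u ω, v ω⟫ | m] =ᵐ[μ] fun ω => ⟪u ω, (μ[v | m]) ω⟫ :=
    condExp_bilin_of_stronglyMeasurable_left (innerSL ℝ) hum huv (hv.integrable one_le_two)
  have hexp : (fun ω => ‖u ω - b • v ω‖ ^ 2) =
      ((fun ω => ‖u ω‖ ^ 2) + (-2 * b) • fun ω => ⟪u ω, v ω⟫) + (b ^ 2) • fun ω => ‖v ω‖ ^ 2 := by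
    ext ω
    simp only [Pi.add_apply, Pi.smul_apply, smul_eq_mul, norm_sub_sq_real, inner_smul_right,
      norm_smul, mul_pow, Real.norm_eq_abs, sq_abs]
    ring
  have hum2 : StronglyMeasurable[m] fun ω => ‖u ω‖ ^ 2 := hum.norm.pow 2
  rw [hexp]
  filter_upwards [condExp_add (hu2.add (huv.smul (-2 * b))) (hv2.smul (b ^ 2)) m,
    condExp_add hu2 (huv.smul (-2 * b)) m, condExp_smul (-2 * b) (fun ω => ⟪u ω, v ω⟫) m,
    condExp_smul (b ^ 2) (fun ω => ‖v ω‖ ^ 2) m, hcross, hv0] with ω h1 h2 h3 h4 h5 h6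
  rw [h1, Pi.add_apply, h2, Pi.add_apply, h3, h4, Pi.smul_apply, Pi.smul_apply, h5, h6,
    condExp_of_stronglyMeasurable hm hum2 hu2]
  simp

/-- Noiseless step `z - b • (g + e)` on an operator value `g` that is strongly monotone and
Lipschitz at `z`, perturbed by an error `e`. -/
theorem norm_sub_smul_add_sq_le {E : Type*} [NormedAddCommGroup E] [InnerProductSpace ℝ E]
    {z g e : E} {b ν L r : ℝ} (hb : 0 ≤ b) (hbL : b * L ^ 2 ≤ ν)
    (hmono : ν * ‖z‖ ^ 2 ≤ ⟪z, g⟫) (hlip : ‖g‖ ≤ L * ‖z‖) (he : ‖e‖ ≤ r) :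
    ‖z - b • (g + e)‖ ^ 2 ≤ (1 - ν * b) * ‖z‖ ^ 2 + (b * r) ^ 2 +
      2 * (b * r) * (Real.sqrt (1 - ν * b) * ‖z‖) := by
  have hg2 : ‖g‖ ^ 2 ≤ L ^ 2 * ‖z‖ ^ 2 := by
    rw [← mul_pow]; exact pow_le_pow_left₀ (norm_nonneg _) hlip 2
  have hcontr : ‖z - b • g‖ ^ 2 ≤ (1 - ν * b) * ‖z‖ ^ 2 := by
    rw [norm_sub_sq_real, inner_smul_right, norm_smul, mul_pow, Real.norm_eq_abs, sq_abs]
    nlinarith [mul_le_mul_of_nonneg_left hmono hb, mul_le_mul_of_nonneg_left hg2 (sq_nonneg b),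
      mul_le_mul_of_nonneg_right hbL (mul_nonneg hb (sq_nonneg ‖z‖))]
  have hroot : ‖z - b • g‖ ≤ Real.sqrt (1 - ν * b) * ‖z‖ := by
    rw [← Real.sqrt_sq (norm_nonneg z), ← Real.sqrt_mul' _ (sq_nonneg _)]
    exact Real.le_sqrt_of_sq_le hcontr
  have htri : ‖z - b • (g + e)‖ ≤ ‖z - b • g‖ + b * r := by
    have hsplit : z - b • (g + e) = (z - b • g) - b • e := by rw [smul_add]; abel
    rw [hsplit]
    refine (norm_sub_le _ _).trans ?_
    rw [norm_smul, Real.norm_of_nonneg hb]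
    gcongr
  have hr : 0 ≤ b * r := mul_nonneg hb ((norm_nonneg e).trans he)
  nlinarith [pow_le_pow_left₀ (norm_nonneg _) htri 2, mul_le_mul_of_nonneg_left hroot hr]

section NatFilt

variable {Ω : Type} [m0 : MeasurableSpace Ω] {dx dy : ℕ}
  {x0 : Ω → EuclideanSpace ℝ (Fin dx)} {y0 : Ω → EuclideanSpace ℝ (Fin dy)}
  {ξ : ℕ → Ω → EuclideanSpace ℝ (Fin dx)} {ψ : ℕ → Ω → EuclideanSpace ℝ (Fin dy)}

theorem natFilt_le (hx0 : Measurable x0) (hy0 : Measurable y0)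
    (hξ : ∀ t, Measurable (ξ t)) (hψ : ∀ t, Measurable (ψ t)) (t : ℕ) :
    natFilt x0 y0 ξ ψ t ≤ m0 :=
  sup_le (sup_le hx0.comap_le hy0.comap_le)
    (iSup₂_le fun s _ => sup_le (hξ s).comap_le (hψ s).comap_le)

theorem natFilt_mono : Monotone (natFilt x0 y0 ξ ψ) := fun _ _ hst =>
  sup_le_sup_left (biSup_mono fun _ h => Finset.range_subset_range.2 hst h) _

theorem measurable_natFilt_fst (t : ℕ) : Measurable[natFilt x0 y0 ξ ψ t] x0 :=
  Measurable.of_comap_le (le_sup_left.trans le_sup_left)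

theorem measurable_natFilt_snd (t : ℕ) : Measurable[natFilt x0 y0 ξ ψ t] y0 :=
  Measurable.of_comap_le (le_sup_right.trans le_sup_left)

theorem comap_noise_le_natFilt (t : ℕ) :
    MeasurableSpace.comap (ξ t) inferInstance ⊔ MeasurableSpace.comap (ψ t) inferInstance ≤
      natFilt x0 y0 ξ ψ (t + 1) :=
  (le_iSup₂_of_le (f := fun s (_ : s ∈ Finset.range (t + 1)) =>
    MeasurableSpace.comap (ξ s) inferInstance ⊔ MeasurableSpace.comap (ψ s) inferInstance)
    t (Finset.self_mem_range_succ t) le_rfl).trans le_sup_right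

theorem measurable_natFilt_noise_fst (t : ℕ) : Measurable[natFilt x0 y0 ξ ψ (t + 1)] (ξ t) :=
  Measurable.of_comap_le (le_sup_left.trans (comap_noise_le_natFilt t))

theorem measurable_natFilt_noise_snd (t : ℕ) : Measurable[natFilt x0 y0 ξ ψ (t + 1)] (ψ t) :=
  Measurable.of_comap_le (le_sup_right.trans (comap_noise_le_natFilt t))

end NatFilt

/-- Lemma E.2 (one-step descent lemma of the slow iterate). -/
theorem one_step_descent_slow
    {Ω : Type} [MeasurableSpace Ω] (μ : Measure Ω) [IsProbabilityMeasure μ]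
    {dx dy : ℕ}
    (F : EuclideanSpace ℝ (Fin dx) → EuclideanSpace ℝ (Fin dy) → EuclideanSpace ℝ (Fin dx))
    (G : EuclideanSpace ℝ (Fin dx) → EuclideanSpace ℝ (Fin dy) → EuclideanSpace ℝ (Fin dy))
    (H : EuclideanSpace ℝ (Fin dy) → EuclideanSpace ℝ (Fin dx))
    (xstar : EuclideanSpace ℝ (Fin dx)) (ystar : EuclideanSpace ℝ (Fin dy))
    (hFroot : F xstar ystar = 0) (hGroot : G xstar ystar = 0)
    -- Assumption 1
    (LH LF : ℝ) (hLH : 0 ≤ LH) (hLF : 0 ≤ LF)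
    (hFH : ∀ y, F (H y) y = 0)
    (hFHuniq : ∀ y x', F x' y = 0 → x' = H y)
    (hHlip : ∀ y₁ y₂, ‖H y₁ - H y₂‖ ≤ LH * ‖y₁ - y₂‖)
    (hFlip : ∀ x' y, ‖F x' y - F (H y) y‖ ≤ LF * ‖x' - H y‖)
    -- Assumption 2
    (LGx LGy : ℝ) (hLGx : 0 ≤ LGx) (hLGy : 0 ≤ LGy)
    (hGlipx : ∀ x' y, ‖G x' y - G (H y) y‖ ≤ LGx * ‖x' - H y‖)
    (hGlipy : ∀ y, ‖G (H y) y - G (H ystar) ystar‖ ≤ LGy * ‖y - ystar‖)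
    -- Assumption 3
    (muF muG : ℝ) (hmuF : 0 < muF) (hmuG : 0 < muG)
    (hFmono : ∀ x' y, muF * ‖x' - H y‖ ^ 2 ≤ ⟪x' - H y, F x' y - F (H y) y⟫)
    (hGmono : ∀ y, muG * ‖y - ystar‖ ^ 2 ≤ ⟪y - ystar, G (H y) y - G (H ystar) ystar⟫)
    -- Assumption 4
    (H' : EuclideanSpace ℝ (Fin dy) → (EuclideanSpace ℝ (Fin dy) →L[ℝ] EuclideanSpace ℝ (Fin dx)))
    (hH' : ∀ y, HasFDerivAt H (H' y) y)
    (SH dH : ℝ) (hSH : 0 ≤ SH) (hdH : dH ∈ Set.Icc (0 : ℝ) 1)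
    (hHtaylor : ∀ y₁ y₂, ‖H y₁ - H y₂ - H' y₂ (y₁ - y₂)‖ ≤ SH * ‖y₁ - y₂‖ ^ (1 + dH))
    -- the two-time-scale stochastic approximation process
    (alpha beta : ℕ → ℝ) (halpha : ∀ t, 0 < alpha t) (hbeta : ∀ t, 0 < beta t)
    (ξ : ℕ → Ω → EuclideanSpace ℝ (Fin dx)) (ψ : ℕ → Ω → EuclideanSpace ℝ (Fin dy))
    (x : ℕ → Ω → EuclideanSpace ℝ (Fin dx)) (y : ℕ → Ω → EuclideanSpace ℝ (Fin dy))
    (hxupd : ∀ t ω, x (t + 1) ω = x t ω - alpha t • (F (x t ω) (y t ω) + ξ t ω))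
    (hyupd : ∀ t ω, y (t + 1) ω = y t ω - beta t • (G (x t ω) (y t ω) + ψ t ω))
    -- measurability
    (hFmeas : Measurable fun p : EuclideanSpace ℝ (Fin dx) × EuclideanSpace ℝ (Fin dy) => F p.1 p.2)
    (hGmeas : Measurable fun p : EuclideanSpace ℝ (Fin dx) × EuclideanSpace ℝ (Fin dy) => G p.1 p.2)
    (hx0meas : Measurable (x 0)) (hy0meas : Measurable (y 0))
    (hξmeas : ∀ t, Measurable (ξ t)) (hψmeas : ∀ t, Measurable (ψ t))
    -- finite initial second moments
    (hx0L2 : Integrable (fun ω => ‖x 0 ω‖ ^ 2) μ) (hy0L2 : Integrable (fun ω => ‖y 0 ω‖ ^ 2) μ)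
    -- noise assumption (martingale differences with bounded second conditional moments)
    (Γ11 Γ22 : ℝ) (hΓ11 : 0 ≤ Γ11) (hΓ22 : 0 ≤ Γ22)
    (hξmean : ∀ t, μ[ξ t | natFilt (x 0) (y 0) ξ ψ t] =ᵐ[μ] 0)
    (hψmean : ∀ t, μ[ψ t | natFilt (x 0) (y 0) ξ ψ t] =ᵐ[μ] 0)
    (hξ2int : ∀ t, Integrable (fun ω => ‖ξ t ω‖ ^ 2) μ)
    (hψ2int : ∀ t, Integrable (fun ω => ‖ψ t ω‖ ^ 2) μ)
    (hξ2 : ∀ t, ∀ᵐ ω ∂μ, (μ[fun ω' => ‖ξ t ω'‖ ^ 2 | natFilt (x 0) (y 0) ξ ψ t]) ω ≤ Γ11)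
    (hψ2 : ∀ t, ∀ᵐ ω ∂μ, (μ[fun ω' => ‖ψ t ω'‖ ^ 2 | natFilt (x 0) (y 0) ξ ψ t]) ω ≤ Γ22)
    -- appendix step-size assumption
    (hαub : ∀ t, alpha t ≤ muF / (4 * LF ^ 2))
    (hβub : ∀ t, beta t ≤ muG / LGy ^ 2)
    (hκub : ∀ t, beta t / alpha t ≤ min (muF * muG / (28 * LH * LGx * max 1 LGy)) (muF / muG))
    (hρub : ∀ t, beta t ^ 2 / alpha t ≤ muF / (16 * LH ^ 2 * LGx ^ 2))
    (hαgrow : ∀ t, alpha (t + 1) ≤ alpha t ∧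
      alpha t / alpha (t + 1) ≤ 1 + min (muF * alpha (t + 1) / 4) (muG * beta (t + 1) / 8))
    (hβgrow : ∀ t, beta (t + 1) ≤ beta t ∧ beta t / beta (t + 1) ≤ 1 + muG * beta (t + 1) / 32)
 :
    ∀ t : ℕ, ∀ᵐ ω ∂μ,
      (μ[fun ω' => ‖y (t + 1) ω' - ystar‖ ^ 2 | natFilt (x 0) (y 0) ξ ψ t]) ω ≤
        (1 - muG * beta t) * ‖y t ω - ystar‖ ^ 2 +
        LGx ^ 2 * beta t ^ 2 * ‖x t ω - H (y t ω)‖ ^ 2 +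
        2 * LGx * beta t * Real.sqrt (1 - muG * beta t) *
          (‖x t ω - H (y t ω)‖ * ‖y t ω - ystar‖) +
        Γ22 * beta t ^ 2 := by
  have hLGy_pos : 0 < LGy := by
    refine hLGy.lt_of_ne fun h => ?_
    have hβ := hβub 0
    rw [← h] at hβ
    simp only [ne_eq, OfNat.ofNat_ne_zero, not_false_eq_true, zero_pow, div_zero] at hβ
    exact (hbeta 0).not_ge hβ
  have hGstar : G (H ystar) ystar = 0 := hFHuniq ystar xstar hFroot ▸ hGroot
  simp only [hGstar, sub_zero] at hGlipy hGmono
  simp only [hFH, sub_zero] at hFlip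
  have hHmeas : Measurable H :=
    (continuous_iff_continuousAt.2 fun z => (hH' z).continuousAt).measurable
  have hle := natFilt_le hx0meas hy0meas hξmeas hψmeas
  have hmeas : ∀ t, Measurable[natFilt (x 0) (y 0) ξ ψ t] (x t) ∧
      Measurable[natFilt (x 0) (y 0) ξ ψ t] (y t) := by
    intro t
    induction t with
    | zero => exact ⟨measurable_natFilt_fst 0, measurable_natFilt_snd 0⟩
    | succ t ih =>
      have hmono : natFilt (x 0) (y 0) ξ ψ t ≤ natFilt (x 0) (y 0) ξ ψ (t + 1) :=
        natFilt_mono t.le_succ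
      have hx := ih.1.mono hmono le_rfl
      have hy := ih.2.mono hmono le_rfl
      rw [funext (hxupd t), funext (hyupd t)]
      exact ⟨hx.sub (((hFmeas.comp (hx.prodMk hy)).add
          (measurable_natFilt_noise_fst t)).const_smul (alpha t)),
        hy.sub (((hGmeas.comp (hx.prodMk hy)).add
          (measurable_natFilt_noise_snd t)).const_smul (beta t))⟩
  have hxm : ∀ t, Measurable (x t) := fun t => (hmeas t).1.mono (hle t) le_rfl
  have hym : ∀ t, Measurable (y t) := fun t => (hmeas t).2.mono (hle t) le_rfl
  have hξL2 : ∀ t, MemLp (ξ t) 2 μ := fun t =>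
    (memLp_two_iff_integrable_sq_norm (hξmeas t).aestronglyMeasurable).2 (hξ2int t)
  have hψL2 : ∀ t, MemLp (ψ t) 2 μ := fun t =>
    (memLp_two_iff_integrable_sq_norm (hψmeas t).aestronglyMeasurable).2 (hψ2int t)
  have hresL2 : ∀ t, MemLp (x t) 2 μ → MemLp (y t) 2 μ →
      MemLp (fun ω => x t ω - H (y t ω)) 2 μ := by
    intro t hx hy
    have hHy : MemLp (fun ω => H (y t ω) - H ystar) 2 μ :=
      (hy.sub (memLp_const ystar)).of_le_mul
        ((hHmeas.comp (hym t)).sub_const _).aestronglyMeasurable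
        (ae_of_all _ fun ω => hHlip (y t ω) ystar)
    exact ((hx.sub (memLp_const (H ystar))).sub hHy).ae_eq (ae_of_all _ fun ω => by simp)
  have hFL2 : ∀ t, MemLp (x t) 2 μ → MemLp (y t) 2 μ →
      MemLp (fun ω => F (x t ω) (y t ω)) 2 μ := fun t hx hy =>
    (hresL2 t hx hy).of_le_mul (hFmeas.comp ((hxm t).prodMk (hym t))).aestronglyMeasurable
      (ae_of_all _ fun ω => hFlip (x t ω) (y t ω))
  have hGL2 : ∀ t, MemLp (x t) 2 μ → MemLp (y t) 2 μ →
      MemLp (fun ω => G (x t ω) (y t ω)) 2 μ := by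
    intro t hx hy
    have hG := hGmeas.comp ((hxm t).prodMk (hym t))
    have hGH := hGmeas.comp ((hHmeas.comp (hym t)).prodMk (hym t))
    have hdiff : MemLp (fun ω => G (x t ω) (y t ω) - G (H (y t ω)) (y t ω)) 2 μ :=
      (hresL2 t hx hy).of_le_mul (hG.sub hGH).aestronglyMeasurable
        (ae_of_all _ fun ω => hGlipx (x t ω) (y t ω))
    have hslow : MemLp (fun ω => G (H (y t ω)) (y t ω)) 2 μ :=
      (hy.sub (memLp_const ystar)).of_le_mul hGH.aestronglyMeasurable
        (ae_of_all _ fun ω => hGlipy (y t ω))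
    exact (hdiff.add hslow).ae_eq (ae_of_all _ fun ω => by simp)
  have hL2 : ∀ t, MemLp (x t) 2 μ ∧ MemLp (y t) 2 μ := by
    intro t
    induction t with
    | zero =>
      exact ⟨(memLp_two_iff_integrable_sq_norm hx0meas.aestronglyMeasurable).2 hx0L2,
        (memLp_two_iff_integrable_sq_norm hy0meas.aestronglyMeasurable).2 hy0L2⟩
    | succ t ih =>
      rw [funext (hxupd t), funext (hyupd t)]
      exact ⟨ih.1.sub (((hFL2 t ih.1 ih.2).add (hξL2 t)).const_smul (alpha t)),
        ih.2.sub (((hGL2 t ih.1 ih.2).add (hψL2 t)).const_smul (beta t))⟩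
  intro t
  have hum : StronglyMeasurable[natFilt (x 0) (y 0) ξ ψ t]
      fun ω => y t ω - ystar - beta t • G (x t ω) (y t ω) :=
    (((hmeas t).2.sub_const ystar).sub ((hGmeas.comp
      ((hmeas t).1.prodMk (hmeas t).2)).const_smul (beta t))).stronglyMeasurable
  have huL2 : MemLp (fun ω => y t ω - ystar - beta t • G (x t ω) (y t ω)) 2 μ :=
    ((hL2 t).2.sub (memLp_const ystar)).sub ((hGL2 t (hL2 t).1 (hL2 t).2).const_smul (beta t))
  have hstep : (fun ω => ‖y (t + 1) ω - ystar‖ ^ 2) = fun ω =>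
      ‖y t ω - ystar - beta t • G (x t ω) (y t ω) - beta t • ψ t ω‖ ^ 2 := by
    ext ω
    rw [hyupd, smul_add]
    congr 2
    abel
  rw [hstep]
  filter_upwards [condExp_norm_sub_smul_sq (hle t) (beta t) hum huL2 (hψL2 t) (hψmean t), hψ2 t]
    with ω hω hψω
  rw [hω]
  have hdrift := norm_sub_smul_add_sq_le (hbeta t).le
    ((le_div_iff₀ (pow_pos hLGy_pos 2)).1 (hβub t)) (hGmono (y t ω)) (hGlipy (y t ω))
    (hGlipx (x t ω) (y t ω))
  rw [add_sub_cancel] at hdrift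
  have hnoise := mul_le_mul_of_nonneg_left hψω (sq_nonneg (beta t))
  linarith
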